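/- arXiv:2307.04314 — 2 statements merged into one kernel-verified Lean document; each statement's English description precedes it below -/
import Mathlib

section
/- Let A ⊆ S² be a Borel measurable set and let σ denote the uniform probability measure on S². Then the μ-measure of the set of directed lines that intersect A in exactly one of their two intersection points with S² (i.e., exactly one of the entry point X and the exit point Y lies in A) equals 2·σ(A)·(1 − σ(A)). -/
open MeasureTheory Metric Real Filter
open scoped ENNReal RealInnerProductSpace Topology

noncomputable section

/-- Euclidean space `ℝⁿ`. -/
abbrev En (n : ℕ) := EuclideanSpace ℝ (Fin n)

/-- The unit sphere `S^{n-1} ⊂ ℝⁿ`. -/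
def unitSphere (n : ℕ) : Set (En n) := Metric.sphere 0 1

/-- The uniform probability (normalized surface) measure on the unit sphere. -/
def sigmaN (n : ℕ) : Measure (En n) :=
  (μH[(n : ℝ) - 1] (unitSphere n))⁻¹ •
    (μH[(n : ℝ) - 1] : Measure (En n)).restrict (unitSphere n)

/-- The open unit disc in the hyperplane orthogonal to `v`. -/
def disc (n : ℕ) (v : En n) : Set (En n) := {z | ⟪v, z⟫ = 0 ∧ ‖z‖ < 1}

/-- Normalized `(n-1)`-dimensional Hausdorff measure on the disc `{z ∈ v⊥ : ‖z‖ < 1}`. -/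
def lambdaN (n : ℕ) (v : En n) : Measure (En n) :=
  (μH[(n : ℝ) - 1] (disc n v))⁻¹ •
    (μH[(n : ℝ) - 1] : Measure (En n)).restrict (disc n v)

/-- The normalized kinematic measure on directed lines meeting the unit sphere,
parametrized by pairs `(v, z)` with `v` the direction and `z ∈ v⊥`, `‖z‖ < 1`. -/
def kinematic (n : ℕ) : Measure (En n × En n) :=
  (sigmaN n).bind (fun v => (Measure.dirac v).prod (lambdaN n v))

/-- The entry point of the line parametrized by `(v, z)` in the unit sphere. -/
def Xpt (n : ℕ) (p : En n × En n) : En n := p.2 - Real.sqrt (1 - ‖p.2‖ ^ 2) • p.1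

/-- The exit point of the line parametrized by `(v, z)` in the unit sphere. -/
def Ypt (n : ℕ) (p : En n × En n) : En n := p.2 + Real.sqrt (1 - ‖p.2‖ ^ 2) • p.1

lemma dim_eq : ((3 : ℕ) : ℝ) - 1 = 2 := by norm_num

lemma sphere_sq {x : En 3} (hx : x ∈ unitSphere 3) : x 0 ^ 2 + x 1 ^ 2 + x 2 ^ 2 = 1 := by
  have h : ‖x‖ = 1 := by simpa [unitSphere] using hx
  have h2 := EuclideanSpace.real_norm_sq_eq x
  rw [h, Fin.sum_univ_three] at h2
  linarith

lemma hausdorff_sphere_lt_top : (μH[2] : Measure (En 3)) (unitSphere 3) < ⊤ := by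
  let f : ℝ × ℝ → En 3 := fun p => WithLp.toLp 2
    (![sin p.1 * cos p.2, sin p.1 * sin p.2, cos p.1] : Fin 3 → ℝ)
  have hf : ContDiff ℝ 1 f := by
    rw [contDiff_euclidean]
    intro i
    fin_cases i <;> simp [f] <;> fun_prop
  let s : Set (ℝ × ℝ) := Set.Icc (-π) π ×ˢ Set.Icc (-π) π
  have hs : IsCompact s := isCompact_Icc.prod isCompact_Icc
  have hc : Convex ℝ s := (convex_Icc _ _).prod (convex_Icc _ _)
  obtain ⟨K, hK⟩ := hf.contDiffOn.exists_lipschitzOnWith (s := s) one_ne_zero hc hs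
  have h1 := hK.hausdorffMeasure_image_le (d := 2) (by norm_num)
  have hsub : unitSphere 3 ⊆ f '' s := by
    intro x hx
    have hx2 := sphere_sq hx
    let z : ℂ := ⟨x 0, x 1⟩
    refine ⟨(arccos (x 2), Complex.arg z), ⟨⟨?_, arccos_le_pi _⟩, ⟨(Complex.neg_pi_lt_arg z).le, Complex.arg_le_pi z⟩⟩, ?_⟩
    · linarith [arccos_nonneg (x 2), pi_pos]
    · have hz : ‖z‖ = sin (arccos (x 2)) := by
        rw [sin_arccos, Complex.norm_def, Complex.normSq_apply]
        congr 1
        simp only [z]; nlinarith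
      have h0 : cos (arccos (x 2)) = x 2 := cos_arccos (by nlinarith) (by nlinarith)
      have h2 := Complex.norm_mul_cos_arg z
      have h3 := Complex.norm_mul_sin_arg z
      rw [hz] at h2 h3
      ext i
      fin_cases i
      · simpa [f] using h2
      · simpa [f] using h3
      · simpa [f] using h0
  refine (measure_mono hsub).trans_lt (h1.trans_lt ?_)
  rw [hausdorffMeasure_prod_real]
  exact ENNReal.mul_lt_top (by simp) hs.measure_lt_top

lemma hausdorff_sphere_pos : (μH[2] : Measure (En 3)) (unitSphere 3) ≠ 0 := by
  intro h
  let f : En 3 → ℝ × ℝ := fun x => (x 0, x 1)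
  have hf : LipschitzWith 1 f := by
    apply LipschitzWith.of_dist_le_mul
    intro x y
    simp only [NNReal.coe_one, one_mul, f, dist_eq_norm]
    have := PiLp.norm_apply_le (x - y)
    exact max_le (this 0) (this 1)
  have h1 := hf.hausdorffMeasure_image_le (d := 2) (by norm_num) (unitSphere 3)
  rw [h, hausdorffMeasure_prod_real] at h1
  have hsub : Set.Icc (0:ℝ) (1/2) ×ˢ Set.Icc (0:ℝ) (1/2) ⊆ f '' unitSphere 3 := by
    rintro ⟨a, b⟩ ⟨⟨ha, ha'⟩, ⟨hb, hb'⟩⟩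
    simp only at ha ha' hb hb'
    refine ⟨WithLp.toLp 2 (![a, b, √(1 - a ^ 2 - b ^ 2)] : Fin 3 → ℝ), ?_, by simp [f]⟩
    simp only [unitSphere, mem_sphere_zero_iff_norm, EuclideanSpace.norm_eq, Fin.sum_univ_three]
    simp
    rw [Real.sq_sqrt (by nlinarith)]
    ring
  have h2 := (measure_mono hsub).trans h1
  rw [Measure.volume_eq_prod, Measure.prod_prod] at h2
  simp at h2

instance : IsProbabilityMeasure (sigmaN 3) := by
  constructor
  simp only [sigmaN, dim_eq, Measure.smul_apply, Measure.restrict_apply_univ, smul_eq_mul]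
  exact ENNReal.inv_mul_cancel hausdorff_sphere_pos hausdorff_sphere_lt_top.ne

lemma meas_sphere : MeasurableSet (unitSphere 3) := Metric.isClosed_sphere.measurableSet

lemma sigma_ae : ∀ᵐ x ∂(sigmaN 3), x ∈ unitSphere 3 :=
  Measure.ae_smul_measure (ae_restrict_mem meas_sphere) _

lemma map_restrict_haus (g : En 3 ≃ₗᵢ[ℝ] En 3) (s : Set (En 3)) (hs : MeasurableSet s) :
    ((μH[2] : Measure (En 3)).restrict s).map g = (μH[2] : Measure (En 3)).restrict (g '' s) := by
  have h := g.toIsometryEquiv.measurePreserving_hausdorffMeasure 2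
  have : g '' s = g.symm ⁻¹' s := g.toEquiv.image_eq_preimage_symm s
  have h2 := h.restrict_preimage (s := g.symm ⁻¹' s) (g.symm.continuous.measurable hs)
  rw [this]
  have h3 : (g.toIsometryEquiv) ⁻¹' (g.symm ⁻¹' s) = s := by ext; simp
  rw [h3] at h2
  exact h2.map_eq

lemma sigma_inv (g : En 3 ≃ₗᵢ[ℝ] En 3) : (sigmaN 3).map g = sigmaN 3 := by
  rw [sigmaN, Measure.map_smul, dim_eq, map_restrict_haus g _ meas_sphere]
  congr 2
  simp [unitSphere]

lemma disc_image (g : En 3 ≃ₗᵢ[ℝ] En 3) (v : En 3) : g '' disc 3 v = disc 3 (g v) := by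
  have : g '' disc 3 v = g.symm ⁻¹' disc 3 v := g.toEquiv.image_eq_preimage_symm _
  rw [this]
  ext z
  simp only [disc, Set.mem_preimage, Set.mem_ofPred_eq, LinearIsometryEquiv.norm_map]
  rw [← g.inner_map_map, g.apply_symm_apply]

lemma meas_disc (v : En 3) : MeasurableSet (disc 3 v) := by
  have h1 : IsClosed {z : En 3 | ⟪v, z⟫ = 0} := isClosed_eq (by fun_prop) continuous_const
  have h2 : IsOpen {z : En 3 | ‖z‖ < 1} := isOpen_lt (by fun_prop) continuous_const
  exact h1.measurableSet.inter h2.measurableSet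

lemma lambda_map (g : En 3 ≃ₗᵢ[ℝ] En 3) (v : En 3) :
    (lambdaN 3 v).map g = lambdaN 3 (g v) := by
  have : (μH[2] : Measure (En 3)) (disc 3 (g v)) = (μH[2] : Measure (En 3)) (disc 3 v) := by
    rw [← disc_image]
    exact g.toIsometryEquiv.hausdorffMeasure_image _ _
  rw [lambdaN, Measure.map_smul, dim_eq, map_restrict_haus g _ (meas_disc v), lambdaN, dim_eq,
    disc_image, this]

lemma disc_haus {v : En 3} (hv : v ∈ unitSphere 3) :
    (μH[2] : Measure (En 3)) (disc 3 v) ≠ 0 ∧ (μH[2] : Measure (En 3)) (disc 3 v) ≠ ⊤ := by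
  have hv0 : v ≠ 0 := by
    rintro rfl; simp [unitSphere] at hv
  let K := (ℝ ∙ v)ᗮ
  have hfin : Module.finrank ℝ K = 2 := by
    have : Fact (Module.finrank ℝ (En 3) = 2 + 1) := ⟨by simp⟩
    exact Submodule.finrank_orthogonal_span_singleton hv0
  have himg : disc 3 v = (Subtype.val : K → En 3) '' ball 0 1 := by
    ext z
    simp only [disc, Set.mem_ofPred_eq, Set.mem_image, mem_ball_zero_iff]
    constructor
    · rintro ⟨h1, h2⟩
      exact ⟨⟨z, Submodule.mem_orthogonal_singleton_iff_inner_right.2 h1⟩, h2, rfl⟩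
    · rintro ⟨w, hw, rfl⟩
      exact ⟨Submodule.mem_orthogonal_singleton_iff_inner_right.1 w.2, hw⟩
  have hh : (μH[2] : Measure (En 3)) (disc 3 v) = (μH[2] : Measure K) (ball 0 1) := by
    rw [himg, isometry_subtype_coe.hausdorffMeasure_image (Or.inl (by norm_num))]
  have : (μH[2] : Measure K) = μH[(Module.finrank ℝ K : ℝ)] := by rw [hfin]; norm_num
  rw [hh, this]
  exact ⟨(measure_ball_pos _ _ one_pos).ne', measure_ball_lt_top.ne⟩

lemma lambda_prob {v : En 3} (hv : v ∈ unitSphere 3) : IsProbabilityMeasure (lambdaN 3 v) := by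
  constructor
  simp only [lambdaN, dim_eq, Measure.smul_apply, Measure.restrict_apply_univ, smul_eq_mul]
  exact ENNReal.inv_mul_cancel (disc_haus hv).1 (disc_haus hv).2

lemma lambda_ae (v : En 3) : ∀ᵐ z ∂(lambdaN 3 v), z ∈ disc 3 v :=
  Measure.ae_smul_measure (ae_restrict_mem (meas_disc v)) _

instance lambda_sfin (v : En 3) : SFinite (lambdaN 3 v) := by
  by_cases h : (μH[2] : Measure (En 3)) (disc 3 v) = ⊤
  · simp only [lambdaN, dim_eq, h]
    simp; infer_instance
  · have : IsFiniteMeasure ((μH[2] : Measure (En 3)).restrict (disc 3 v)) :=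
      ⟨by simpa using lt_top_iff_ne_top.2 h⟩
    simp only [lambdaN, dim_eq]
    infer_instance

open scoped Pointwise in
lemma lambda_norm_lt {v : En 3} (hv : v ∈ unitSphere 3) {r : ℝ} (hr : 0 < r) (hr1 : r ≤ 1) :
    lambdaN 3 v {z | ‖z‖ < r} = ENNReal.ofReal (r ^ 2) := by
  have hm : MeasurableSet {z : En 3 | ‖z‖ < r} := (isOpen_lt (by fun_prop) continuous_const).measurableSet
  simp only [lambdaN, dim_eq, Measure.smul_apply, Measure.restrict_apply hm, smul_eq_mul]
  have : {z : En 3 | ‖z‖ < r} ∩ disc 3 v = r • disc 3 v := by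
    ext z
    rw [Set.mem_smul_set_iff_inv_smul_mem₀ hr.ne']
    simp only [disc, Set.mem_inter_iff, Set.mem_ofPred_eq, inner_smul_right, norm_smul, norm_inv,
      Real.norm_of_nonneg hr.le, mul_eq_zero, inv_eq_zero, hr.ne', false_or]
    rw [inv_mul_lt_iff₀ hr, mul_one]
    constructor
    · tauto
    · rintro ⟨h1, h2⟩; exact ⟨h2, h1, h2.trans_le hr1⟩
  rw [this, Measure.hausdorffMeasure_smul₀ (by norm_num) hr.ne']
  rw [ENNReal.smul_def, smul_eq_mul, mul_comm, mul_assoc, ENNReal.mul_inv_cancel (disc_haus hv).1 (disc_haus hv).2,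
    mul_one]
  rw [ENNReal.ofReal]
  congr 1
  ext
  simp [abs_of_pos hr, hr.le]

/-- Uniform distribution on `[-1, 1]`. -/
def Uu : Measure ℝ := (volume.restrict (Set.Icc (0:ℝ) 1)).map (fun s => 2 * s - 1)

instance : IsProbabilityMeasure (volume.restrict (Set.Icc (0:ℝ) 1)) := ⟨by simp⟩

instance : IsProbabilityMeasure Uu :=
  Measure.isProbabilityMeasure_map (by fun_prop)

lemma Uu_ae : ∀ᵐ x ∂Uu, x ∈ Set.Icc (-1 : ℝ) 1 := by
  refine (ae_map_iff (p := fun x => x ∈ Set.Icc (-1 : ℝ) 1) (by fun_prop) measurableSet_Icc).2 ?_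
  filter_upwards [ae_restrict_mem measurableSet_Icc] with s hs
  constructor <;> linarith [hs.1, hs.2]

lemma Uu_moment (n : ℕ) : ∫ x, x ^ n ∂Uu = (1 - (-1) ^ (n + 1)) / (2 * (n + 1)) := by
  rw [Uu, integral_map (by fun_prop) (by fun_prop), integral_Icc_eq_integral_Ioc,
    ← intervalIntegral.integral_of_le zero_le_one]
  have := intervalIntegral.integral_comp_mul_sub (a := 0) (b := 1) (fun x : ℝ => x ^ n) (c := 2)
    two_ne_zero 1
  rw [this, integral_pow]
  norm_num
  field_simp

lemma lambda_normsq {v : En 3} (hv : v ∈ unitSphere 3) :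
    (lambdaN 3 v).map (fun z => ‖z‖ ^ 2) = volume.restrict (Set.Icc (0:ℝ) 1) := by
  have := lambda_prob hv
  have hmm : Measurable (fun z : En 3 => ‖z‖ ^ 2) := by fun_prop
  have : IsProbabilityMeasure ((lambdaN 3 v).map (fun z => ‖z‖ ^ 2)) :=
    Measure.isProbabilityMeasure_map (by fun_prop)
  refine Measure.ext_of_Ici _ _ fun a => ?_
  have key : (lambdaN 3 v).map (fun z => ‖z‖ ^ 2) (Set.Iio a)
      = volume.restrict (Set.Icc (0:ℝ) 1) (Set.Iio a) := by
    rw [Measure.map_apply hmm measurableSet_Iio, Measure.restrict_apply measurableSet_Iio]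
    rcases le_or_gt a 0 with ha | ha
    · have h1 : (fun z : En 3 => ‖z‖ ^ 2) ⁻¹' Set.Iio a = ∅ := by
        ext z; simp; nlinarith [sq_nonneg ‖z‖]
      have h2 : Set.Iio a ∩ Set.Icc 0 1 = ∅ := by
        ext z; simp; intros; linarith
      rw [h1, h2]; simp
    rcases le_or_gt a 1 with ha1 | ha1
    · have h1 : (fun z : En 3 => ‖z‖ ^ 2) ⁻¹' Set.Iio a = {z | ‖z‖ < √a} := by
        ext z; simp [Real.lt_sqrt]
      have h2 : Set.Iio a ∩ Set.Icc 0 1 = Set.Ico 0 a := by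
        ext z; simp; constructor
        · tauto
        · rintro ⟨h, h'⟩; exact ⟨h', h, by linarith⟩
      rw [h1, h2, lambda_norm_lt hv (Real.sqrt_pos.2 ha) (Real.sqrt_le_one.2 ha1), Real.sq_sqrt ha.le]
      simp
    · have h2 : Set.Iio a ∩ Set.Icc 0 1 = Set.Icc 0 1 := by
        ext z; simp; intros; linarith
      rw [h2]
      have : ∀ᵐ z ∂(lambdaN 3 v), z ∈ (fun z : En 3 => ‖z‖ ^ 2) ⁻¹' Set.Iio a := by
        filter_upwards [lambda_ae v] with z hz
        have := hz.2
        simp; nlinarith [norm_nonneg z]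
      rw [measure_congr (s := (fun z : En 3 => ‖z‖ ^ 2) ⁻¹' Set.Iio a) (eventuallyEq_univ.2 this)]
      simp
  rw [← Set.compl_Iio, prob_compl_eq_one_sub measurableSet_Iio,
    prob_compl_eq_one_sub measurableSet_Iio, key]

lemma lambda_law {v : En 3} (hv : v ∈ unitSphere 3) :
    (lambdaN 3 v).map (fun z => 2 * ‖z‖ ^ 2 - 1) = Uu := by
  rw [Uu, ← lambda_normsq hv, Measure.map_map (by fun_prop) (by fun_prop)]
  rfl

lemma ext_moment (μ ν : Measure ℝ) [IsProbabilityMeasure μ] [IsProbabilityMeasure ν]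
    (hμ : ∀ᵐ x ∂μ, x ∈ Set.Icc (-1 : ℝ) 1) (hν : ∀ᵐ x ∂ν, x ∈ Set.Icc (-1 : ℝ) 1)
    (h : ∀ n : ℕ, ∫ x, x ^ n ∂μ = ∫ x, x ^ n ∂ν) : μ = ν := by
  have hpi : ∀ (ρ : Measure ℝ) [IsProbabilityMeasure ρ], (∀ᵐ x ∂ρ, x ∈ Set.Icc (-1 : ℝ) 1) →
      ∀ n : ℕ, Integrable (fun x => x ^ n) ρ := by
    intro ρ _ hρ n
    refine Integrable.of_bound (by fun_prop) 1 ?_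
    filter_upwards [hρ] with x hx
    rw [norm_pow, Real.norm_eq_abs]
    exact pow_le_one₀ (abs_nonneg _) (abs_le.2 hx)
  have hpp : ∀ (ρ : Measure ℝ) [IsProbabilityMeasure ρ], (∀ᵐ x ∂ρ, x ∈ Set.Icc (-1 : ℝ) 1) →
      ∀ p : Polynomial ℝ, Integrable (fun x => p.eval x) ρ ∧
        ∫ x, p.eval x ∂ρ = ∑ i ∈ Finset.range (p.natDegree + 1), p.coeff i * ∫ x, x ^ i ∂ρ := by
    intro ρ _ hρ p
    simp only [Polynomial.eval_eq_sum_range]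
    constructor
    · exact integrable_finsetSum _ fun i _ => (hpi ρ hρ i).const_mul _
    · rw [integral_finsetSum _ fun i _ => (hpi ρ hρ i).const_mul _]
      simp only [integral_const_mul]
  apply ext_of_forall_integral_eq_of_IsFiniteMeasure
  intro f
  have hle : ∀ (ρ : Measure ℝ) [IsProbabilityMeasure ρ], (∀ᵐ x ∂ρ, x ∈ Set.Icc (-1 : ℝ) 1) →
      ∀ ε, ∀ p : Polynomial ℝ, (∀ x ∈ Set.Icc (-1:ℝ) 1, |p.eval x - f x| < ε) →
      |∫ x, p.eval x ∂ρ - ∫ x, f x ∂ρ| ≤ ε := by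
    intro ρ _ hρ ε p hp
    rw [← integral_sub (hpp ρ hρ p).1 (f.integrable ρ)]
    have := norm_integral_le_of_norm_le_const (μ := ρ) (f := fun x => p.eval x - f x) (C := ε) (by
      filter_upwards [hρ] with x hx
      exact (hp x hx).le)
    simpa using this
  refine eq_of_abs_sub_le_all fun ε hε => ?_
  obtain ⟨p, hp⟩ := exists_polynomial_near_of_continuousOn (-1) 1 f f.continuous.continuousOn (ε/2)
    (by positivity)
  have h1 := hle μ hμ _ p hp
  have h2 := hle ν hν _ p hp
  have h3 : ∫ x, p.eval x ∂μ = ∫ x, p.eval x ∂ν := by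
    rw [(hpp μ hμ p).2, (hpp ν hν p).2]; simp only [h]
  rw [h3] at h1
  rw [abs_le] at *
  constructor <;> linarith [h1.1, h1.2, h2.1, h2.2]

lemma exists_isom {x y : En 3} (h : ‖x‖ = ‖y‖) : ∃ g : En 3 ≃ₗᵢ[ℝ] En 3, g x = y :=
  ⟨(ℝ ∙ (x - y))ᗮ.reflection, Submodule.reflection_sub h⟩

lemma exists_isom_pair {x y x' y' : En 3} (hx : ‖x‖ = ‖x'‖) (hy : ‖y‖ = ‖y'‖)
    (hi : ⟪x, y⟫ = ⟪x', y'⟫) : ∃ g : En 3 ≃ₗᵢ[ℝ] En 3, g x = x' ∧ g y = y' := by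
  obtain ⟨g, hg⟩ := exists_isom hx
  refine ⟨g.trans (ℝ ∙ (g y - y'))ᗮ.reflection, ?_, ?_⟩
  · rw [LinearIsometryEquiv.trans_apply, hg]
    apply Submodule.reflection_mem_subspace_eq_self
    rw [Submodule.mem_orthogonal_singleton_iff_inner_left, inner_sub_right, ← hi, ← hg, g.inner_map_map, sub_self]
  · rw [LinearIsometryEquiv.trans_apply]
    exact Submodule.reflection_sub (by rw [g.norm_map, hy])

lemma inner_sing (i : Fin 3) (x : En 3) : ⟪(EuclideanSpace.single i (1:ℝ) : En 3), x⟫ = x i := by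
  have := EuclideanSpace.inner_single_left (𝕜 := ℝ) i (1:ℝ) x
  rw [this]; simp

/-- moment of the sphere measure -/
def Mo (n : ℕ) : ℝ := ∫ x, (x 0) ^ n ∂(sigmaN 3)

lemma coord_le {x : En 3} (hx : x ∈ unitSphere 3) (i : Fin 3) : |x i| ≤ 1 := by
  have h : ‖x‖ = 1 := by simpa [unitSphere] using hx
  rw [← h]; exact PiLp.norm_apply_le x i

lemma int_mon (i j : Fin 3) (a b : ℕ) :
    Integrable (fun x : En 3 => x i ^ a * x j ^ b) (sigmaN 3) := by
  refine Integrable.of_bound (by fun_prop) 1 ?_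
  filter_upwards [sigma_ae] with x hx
  rw [norm_mul, norm_pow, norm_pow]
  exact mul_le_one₀ (pow_le_one₀ (norm_nonneg _) (coord_le hx i)) (by positivity)
    (pow_le_one₀ (norm_nonneg _) (coord_le hx j))

lemma moment_inner (u : En 3) (n : ℕ) : ∫ x, ⟪u, x⟫ ^ n ∂(sigmaN 3) = ‖u‖ ^ n * Mo n := by
  obtain ⟨g, hg⟩ := exists_isom (x := ‖u‖ • EuclideanSpace.single (0 : Fin 3) (1:ℝ)) (y := u) (by
    simp [norm_smul])
  have h := sigma_inv g
  conv_lhs => rw [← h]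
  rw [integral_map (by fun_prop) (by fun_prop)]
  rw [Mo, ← integral_const_mul]
  congr 1
  ext x
  conv_lhs => rw [← hg]
  rw [g.inner_map_map, inner_smul_left, inner_sing]
  simp [mul_pow]

lemma Mo_odd (k : ℕ) : Mo (2 * k + 1) = 0 := by
  have h := sigma_inv (LinearIsometryEquiv.neg ℝ)
  have h1 : Mo (2 * k + 1) = - Mo (2 * k + 1) := by
    conv_lhs => rw [Mo, ← h]
    rw [integral_map (by fun_prop) (by fun_prop), Mo, ← integral_neg]
    congr 1; ext x
    simp [Odd.neg_pow (⟨k, rfl⟩ : Odd (2 * k + 1))]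
  linarith

lemma Mo_cross (k : ℕ) (i : Fin 3) (hi : i ≠ 0) :
    ((2 * k + 2).choose 2 : ℝ) * ∫ x, (x 0) ^ (2 * k) * (x i) ^ 2 ∂(sigmaN 3)
      = (k + 1) * Mo (2 * k + 2) := by
  let I : ℕ → ℝ := fun j => ∫ x, (x i) ^ j * (x 0) ^ (2 * k + 2 - j) ∂(sigmaN 3)
  let P : Polynomial ℝ := ∑ j ∈ Finset.range (2 * k + 2 + 1),
    Polynomial.monomial j (I j * ((2 * k + 2).choose j : ℝ))
  let Q : Polynomial ℝ := Polynomial.expand ℝ 2 ((1 + Polynomial.X) ^ (k + 1)) *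
    Polynomial.C (Mo (2 * k + 2))
  have hPQ : P = Q := by
    apply Polynomial.funext
    intro s
    have h1 := moment_inner (s • EuclideanSpace.single i (1:ℝ) + EuclideanSpace.single 0 (1:ℝ)) (2 * k + 2)
    have h2 : ‖s • EuclideanSpace.single i (1:ℝ) + EuclideanSpace.single (0 : Fin 3) (1:ℝ)‖ ^ 2 = 1 + s ^ 2 := by
      rw [norm_add_sq_real, norm_smul, inner_smul_left, inner_sing]
      simp [hi]; ring
    have h3 : ∀ x : En 3, ⟪s • EuclideanSpace.single i (1:ℝ) + EuclideanSpace.single (0 : Fin 3) (1:ℝ), x⟫ = s * x i + x 0 := by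
      intro x
      rw [inner_add_left, inner_smul_left, inner_sing, inner_sing]
      simp
    have h4 : ‖s • EuclideanSpace.single i (1:ℝ) + EuclideanSpace.single (0 : Fin 3) (1:ℝ)‖ ^ (2 * k + 2) = (1 + s ^ 2) ^ (k + 1) := by
      rw [← h2, ← pow_mul]; ring_nf
    simp only [h3, h4] at h1
    have h5 : ∀ x : En 3, (s * x i + x 0) ^ (2 * k + 2) = ∑ j ∈ Finset.range (2 * k + 2 + 1),
        (s ^ j * ((2 * k + 2).choose j : ℝ)) * (x i ^ j * x 0 ^ (2 * k + 2 - j)) := by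
      intro x
      rw [add_pow]
      refine Finset.sum_congr rfl fun j _ => ?_
      rw [mul_pow]; ring
    simp only [h5] at h1
    rw [integral_finsetSum _ fun j _ => (int_mon i 0 _ _).const_mul _] at h1
    simp only [integral_const_mul] at h1
    simp only [P, Q, Polynomial.eval_finsetSum, Polynomial.eval_monomial, Polynomial.eval_mul, Polynomial.expand_eval, Polynomial.eval_pow, Polynomial.eval_add, Polynomial.eval_one, Polynomial.eval_X, Polynomial.eval_C]
    rw [← h1]
    refine Finset.sum_congr rfl fun j _ => ?_
    simp only [I]; ring
  have hc := congrArg (fun p => Polynomial.coeff p 2) hPQ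
  simp only [P, Q, Polynomial.finsetSum_coeff, Polynomial.coeff_monomial, Polynomial.coeff_mul_C] at hc
  rw [Polynomial.coeff_expand two_pos, Finset.sum_ite_eq' ] at hc
  simp [Polynomial.coeff_one_add_X_pow, I] at hc
  rw [← hc, mul_comm]
  congr 2
  ext x; ring

lemma Mo_even (k : ℕ) : Mo (2 * k) = 1 / (2 * k + 1) := by
  induction k with
  | zero => simp [Mo]
  | succ k ih =>
    have h1 := Mo_cross k 1 (by decide)
    have h2 := Mo_cross k 2 (by decide)
    have h3 : Mo (2 * k) = Mo (2 * k + 2) + ∫ x, (x 0) ^ (2 * k) * (x 1) ^ 2 ∂(sigmaN 3)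
        + ∫ x, (x 0) ^ (2 * k) * (x 2) ^ 2 ∂(sigmaN 3) := by
      have : Mo (2 * k + 2) = ∫ x, (x 0) ^ (2 * k) * (x 0) ^ 2 ∂(sigmaN 3) := by
        simp only [Mo, pow_add]
      rw [this, ← integral_add (int_mon _ _ _ _) (int_mon _ _ _ _),
        ← integral_add (by exact (int_mon 0 0 _ _).add (int_mon 0 1 _ _)) (int_mon _ _ _ _), Mo]
      apply integral_congr_ae
      filter_upwards [sigma_ae] with x hx
      have := sphere_sq hx
      rw [← mul_add, ← mul_add, this, mul_one]
    rw [ih] at h3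
    rw [Nat.cast_choose_two] at h1 h2
    push_cast at h1 h2 ⊢
    rw [show 2 * (k + 1) = 2 * k + 2 by ring]
    have hk : (0:ℝ) ≤ k := Nat.cast_nonneg k
    generalize Mo (2 * k + 2) = M at *
    generalize (∫ x, (x 0) ^ (2 * k) * (x 1) ^ 2 ∂(sigmaN 3)) = a at *
    generalize (∫ x, (x 0) ^ (2 * k) * (x 2) ^ 2 ∂(sigmaN 3)) = b at *
    have ha : (2 * k + 1) * a = M := by
      have : ((k:ℝ) + 1) * ((2 * k + 1) * a) = (k + 1) * M := by rw [← h1]; ring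
      exact mul_left_cancel₀ (by positivity) this
    have hb : (2 * k + 1) * b = M := by
      have : ((k:ℝ) + 1) * ((2 * k + 1) * b) = (k + 1) * M := by rw [← h2]; ring
      exact mul_left_cancel₀ (by positivity) this
    rw [div_eq_iff (by positivity)] at h3
    rw [eq_div_iff (by positivity)]
    linarith

lemma sigma_law {y : En 3} (hy : y ∈ unitSphere 3) : (sigmaN 3).map (fun x => ⟪y, x⟫) = Uu := by
  have hyn : ‖y‖ = 1 := by simpa [unitSphere] using hy
  have hm : Measurable (fun x : En 3 => ⟪y, x⟫) := by fun_prop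
  have : IsProbabilityMeasure ((sigmaN 3).map (fun x => ⟪y, x⟫)) :=
    Measure.isProbabilityMeasure_map hm.aemeasurable
  apply ext_moment _ _ _ Uu_ae
  · intro n
    rw [integral_map hm.aemeasurable (by fun_prop), moment_inner, Uu_moment, hyn, one_pow, one_mul]
    obtain ⟨k, rfl | rfl⟩ := Nat.even_or_odd' n
    · rw [Mo_even, pow_succ, pow_mul]; push_cast; field_simp; norm_num
    · rw [Mo_odd, show 2 * k + 1 + 1 = 2 * (k + 1) by ring, pow_mul]; norm_num
  · refine (ae_map_iff (p := fun x => x ∈ Set.Icc (-1 : ℝ) 1) hm.aemeasurable measurableSet_Icc).2 ?_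
    filter_upwards [sigma_ae] with x hx
    have hxn : ‖x‖ = 1 := by simpa [unitSphere] using hx
    have := abs_real_inner_le_norm y x
    rw [hyn, hxn, one_mul] at this
    exact abs_le.1 this

abbrev Gr : Type := ↥(unitary (En 3 →L[ℝ] En 3))

instance : ContinuousStar (En 3 →L[ℝ] En 3) :=
  ⟨(ContinuousLinearMap.adjoint (𝕜 := ℝ) (E := En 3) (F := En 3)).continuous⟩

instance : CompactSpace Gr := by
  refine isCompact_iff_compactSpace.1 (?_ : IsCompact (unitary (En 3 →L[ℝ] En 3) : Set (En 3 →L[ℝ] En 3)))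
  refine Metric.isCompact_of_isClosed_isBounded ?_ ?_
  · exact isClosed_unitary
  · refine (Metric.isBounded_closedBall (x := (0 : En 3 →L[ℝ] En 3)) (r := 1)).subset fun g hg => ?_
    rw [mem_closedBall_zero_iff]
    exact (CStarRing.norm_of_mem_unitary hg).le

instance : SecondCountableTopology (En 3 →L[ℝ] En 3) := inferInstance
instance : SecondCountableTopology Gr := inferInstance
instance : BorelSpace Gr := inferInstance

/-- Haar measure -/
def eta : Measure Gr := Measure.haarMeasure ⊤

instance : IsProbabilityMeasure eta := ⟨Measure.haarMeasure_self⟩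
instance : eta.IsMulLeftInvariant := by unfold eta; infer_instance

/-- diagonal action -/
def act (g : Gr) (p : En 3 × En 3) : En 3 × En 3 :=
  ((g : En 3 →L[ℝ] En 3) p.1, (g : En 3 →L[ℝ] En 3) p.2)

lemma act_cont : Continuous (fun q : Gr × (En 3 × En 3) => act q.1⁻¹ q.2) := by
  have h : Continuous (fun q : Gr × (En 3 × En 3) => ((q.1⁻¹ : Gr) : En 3 →L[ℝ] En 3)) :=
    continuous_subtype_val.comp (continuous_inv.comp continuous_fst)
  exact (h.clm_apply (continuous_fst.comp continuous_snd)).prodMk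
    (h.clm_apply (continuous_snd.comp continuous_snd))

lemma act_mul (g h : Gr) (p : En 3 × En 3) : act (g * h) p = act g (act h p) := rfl

lemma act_one (p : En 3 × En 3) : act 1 p = p := rfl

def DiagInv (ν : Measure (En 3 × En 3)) : Prop :=
  ∀ g : En 3 ≃ₗᵢ[ℝ] En 3, ν.map (Prod.map g g) = ν

/-- averaged function -/
def avg (B : Set (En 3 × En 3)) (p : En 3 × En 3) : ℝ≥0∞ :=
  ∫⁻ g, B.indicator 1 (act g⁻¹ p) ∂eta

lemma avg_meas_aux {B : Set (En 3 × En 3)} (hB : MeasurableSet B) :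
    Measurable (fun q : Gr × (En 3 × En 3) => (B.indicator 1 (act q.1⁻¹ q.2) : ℝ≥0∞)) :=
  (measurable_one.indicator hB).comp act_cont.measurable

lemma avg_meas {B : Set (En 3 × En 3)} (hB : MeasurableSet B) : Measurable (avg B) :=
  Measurable.lintegral_prod_left' (f := fun q : Gr × (En 3 × En 3) => (B.indicator 1 (act q.1⁻¹ q.2) : ℝ≥0∞)) (avg_meas_aux hB)

lemma avg_int {B : Set (En 3 × En 3)} (hB : MeasurableSet B) (ν : Measure (En 3 × En 3))
    [IsProbabilityMeasure ν] (hν : DiagInv ν) : ν B = ∫⁻ p, avg B p ∂ν := by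
  unfold avg
  rw [lintegral_lintegral_swap]
  · have : ∀ g : Gr, ∫⁻ p, (B.indicator 1 (act g⁻¹ p) : ℝ≥0∞) ∂ν = ν B := by
      intro g
      have h := hν (Unitary.linearIsometryEquiv g⁻¹)
      conv_rhs => rw [← h, ← lintegral_indicator_one hB]
      rw [lintegral_map (measurable_one.indicator hB) (by fun_prop)]
      rfl
    simp [this]
  · exact ((avg_meas_aux hB).comp measurable_swap).aemeasurable

lemma avg_inv (B : Set (En 3 × En 3)) (g : En 3 ≃ₗᵢ[ℝ] En 3) (p : En 3 × En 3) :
    avg B (g p.1, g p.2) = avg B p := by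
  let h : Gr := Unitary.linearIsometryEquiv.symm g
  have hp : (g p.1, g p.2) = act h p := rfl
  rw [hp]
  unfold avg
  rw [← lintegral_mul_left_eq_self _ h]
  congr 1; ext k
  rw [← act_mul]
  congr 2
  group

lemma diag_inv_unique (ν₁ ν₂ : Measure (En 3 × En 3)) [IsProbabilityMeasure ν₁]
    [IsProbabilityMeasure ν₂] (h1 : DiagInv ν₁) (h2 : DiagInv ν₂)
    (s1 : ∀ᵐ p ∂ν₁, p ∈ unitSphere 3 ×ˢ unitSphere 3)
    (s2 : ∀ᵐ p ∂ν₂, p ∈ unitSphere 3 ×ˢ unitSphere 3)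
    (hl : ν₁.map (fun p => ⟪p.1, p.2⟫) = ν₂.map (fun p => ⟪p.1, p.2⟫)) : ν₁ = ν₂ := by
  ext B hB
  rw [avg_int hB ν₁ h1, avg_int hB ν₂ h2]
  let w : ℝ → En 3 × En 3 := fun t => (EuclideanSpace.single 0 1,
    t • EuclideanSpace.single 0 1 + √(1 - t ^ 2) • EuclideanSpace.single 1 1)
  have hw : Measurable w := by
    have : Continuous w := by fun_prop
    exact this.measurable
  have key : ∀ p ∈ unitSphere 3 ×ˢ unitSphere 3, avg B p = avg B (w ⟪p.1, p.2⟫) := by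
    rintro ⟨x, y⟩ ⟨hx, hy⟩
    have hx : ‖x‖ = 1 := by simpa [unitSphere] using hx
    have hy : ‖y‖ = 1 := by simpa [unitSphere] using hy
    have hb := abs_real_inner_le_norm x y
    rw [hx, hy, one_mul] at hb
    set t := ⟪x, y⟫ with ht
    have ht2 : t ^ 2 ≤ 1 := by rw [← sq_abs]; nlinarith [abs_nonneg t]
    have hn : ‖(w t).2‖ = 1 := by
      have : ‖(w t).2‖ ^ 2 = 1 := by
        simp only [w]
        rw [norm_add_sq_real, inner_smul_left, inner_smul_right, norm_smul, norm_smul, inner_sing, mul_pow, mul_pow]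
        simp [Real.sq_sqrt (sub_nonneg.2 ht2)]
      nlinarith [norm_nonneg (w t).2]
    have hi : ⟪(w t).1, (w t).2⟫ = t := by
      simp only [w]
      rw [inner_sing]; simp
    obtain ⟨g, hg1, hg2⟩ := exists_isom_pair (x := x) (y := y) (x' := (w t).1) (y' := (w t).2)
      (by rw [hx]; simp [w]) (by rw [hy, hn]) (by rw [hi])
    have := avg_inv B g (x, y)
    simp only [hg1, hg2] at this
    exact this.symm
  have e : ∀ (ν : Measure (En 3 × En 3)), (∀ᵐ p ∂ν, p ∈ unitSphere 3 ×ˢ unitSphere 3) →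
      ∫⁻ p, avg B p ∂ν = ∫⁻ t, avg B (w t) ∂(ν.map (fun p => ⟪p.1, p.2⟫)) := by
    intro ν hν
    rw [lintegral_map (f := fun t => avg B (w t)) ((avg_meas hB).comp hw) (by fun_prop)]
    apply lintegral_congr_ae
    filter_upwards [hν] with p hp using key p hp
  rw [e ν₁ s1, e ν₂ s2, hl]

/-- base point -/
def e0 : En 3 := EuclideanSpace.single 0 1

lemma e0_mem : e0 ∈ unitSphere 3 := by simp [unitSphere, e0]

/-- explicit reflection moving the base point to `p.1` -/
def Phi (p : En 3 × En 3) : En 3 × En 3 :=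
  (p.1, p.2 - (2 * (⟪e0 - p.1, p.2⟫ / ‖e0 - p.1‖ ^ 2)) • (e0 - p.1))

lemma Phi_meas : Measurable Phi := by
  unfold Phi
  fun_prop

lemma ker_eq {v : En 3} (hv : v ∈ unitSphere 3) :
    (Measure.dirac v).prod (lambdaN 3 v) = ((lambdaN 3 e0).map (Prod.mk v)).map Phi := by
  have hv' : ‖v‖ = 1 := by simpa [unitSphere] using hv
  have he' : ‖e0‖ = 1 := by simpa [unitSphere] using e0_mem
  let g := (ℝ ∙ (e0 - v))ᗮ.reflection
  have hg : g e0 = v := Submodule.reflection_sub (by rw [hv', he'])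
  have := lambda_map g e0
  rw [hg] at this
  rw [Measure.dirac_prod, ← this, Measure.map_map (by fun_prop) (by fun_prop),
    Measure.map_map Phi_meas (by fun_prop)]
  congr 1
  ext1 z
  simp only [Function.comp, Phi]
  congr 1
  simp only [g]
  rw [Submodule.reflection_orthogonal_apply, Submodule.reflection_singleton_apply]
  simp [two_smul, two_mul, add_smul]

lemma ker_meas : AEMeasurable (fun v => (Measure.dirac v).prod (lambdaN 3 v)) (sigmaN 3) := by
  have := lambda_prob e0_mem
  refine ⟨fun v => ((lambdaN 3 e0).map (Prod.mk v)).map Phi, ?_, ?_⟩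
  · exact (Measure.measurable_map _ Phi_meas).comp Measurable.map_prodMk_left
  · filter_upwards [sigma_ae] with v hv using ker_eq hv

lemma kin_lint {f : En 3 × En 3 → ℝ≥0∞} (hf : Measurable f) :
    ∫⁻ p, f p ∂(kinematic 3) = ∫⁻ v, ∫⁻ z, f (v, z) ∂(lambdaN 3 v) ∂(sigmaN 3) := by
  rw [kinematic, Measure.lintegral_bind ker_meas hf.aemeasurable]
  congr 1; ext v
  rw [Measure.dirac_prod, lintegral_map hf (by fun_prop)]

lemma kin_apply {s : Set (En 3 × En 3)} (hs : MeasurableSet s) :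
    kinematic 3 s = ∫⁻ v, lambdaN 3 v (Prod.mk v ⁻¹' s) ∂(sigmaN 3) := by
  rw [kinematic, Measure.bind_apply hs ker_meas]
  congr 1; ext v
  rw [Measure.dirac_prod, Measure.map_apply (by fun_prop) hs]

instance : IsProbabilityMeasure (kinematic 3) := by
  constructor
  rw [kin_apply MeasurableSet.univ]
  have : ∫⁻ v, lambdaN 3 v (Prod.mk v ⁻¹' Set.univ) ∂(sigmaN 3) = ∫⁻ v, 1 ∂(sigmaN 3) := by
    apply lintegral_congr_ae
    filter_upwards [sigma_ae] with v hv
    have := lambda_prob hv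
    simp
  rw [this]; simp

lemma kin_inv : DiagInv (kinematic 3) := by
  intro g
  refine Measure.ext_of_lintegral _ fun f hf => ?_
  rw [lintegral_map hf (by fun_prop), kin_lint (f := fun a => f (Prod.map g g a)) (hf.comp (by fun_prop)), kin_lint hf]
  have h2 : ∀ v, ∫⁻ z, (f (Prod.map g g (v, z))) ∂(lambdaN 3 v) = ∫⁻ z, f (g v, z) ∂(lambdaN 3 (g v)) := by
    intro v
    rw [← lambda_map g v, lintegral_map (f := fun z => f (g v, z)) (hf.comp (by fun_prop)) (by fun_prop)]
    rfl
  simp only [h2]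
  conv_rhs => rw [← sigma_inv g]
  exact (g.toHomeomorph.measurableEmbedding.lintegral_map
    (fun v => ∫⁻ z, f (v, z) ∂(lambdaN 3 v))).symm

/-- pair of entry and exit points -/
def XY (p : En 3 × En 3) : En 3 × En 3 := (Xpt 3 p, Ypt 3 p)

lemma XY_meas : Measurable XY := by
  unfold XY Xpt Ypt
  fun_prop

lemma XY_norm {v z : En 3} (hv : v ∈ unitSphere 3) (hz : z ∈ disc 3 v) :
    XY (v, z) ∈ unitSphere 3 ×ˢ unitSphere 3 ∧ ⟪(XY (v, z)).1, (XY (v, z)).2⟫ = 2 * ‖z‖ ^ 2 - 1 := by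
  have hv' : ‖v‖ = 1 := by simpa [unitSphere] using hv
  obtain ⟨h1, h2⟩ := hz
  have h1' : ⟪z, v⟫ = 0 := by rw [real_inner_comm]; exact h1
  have h3 : 0 ≤ 1 - ‖z‖ ^ 2 := by nlinarith [norm_nonneg z]
  have hs := Real.sq_sqrt h3
  simp only [XY, Xpt, Ypt, unitSphere, Set.mem_prod, mem_sphere_zero_iff_norm]
  set r := √(1 - ‖z‖ ^ 2)
  refine ⟨⟨?_, ?_⟩, ?_⟩
  · have : ‖z - r • v‖ ^ 2 = 1 := by
      rw [norm_sub_sq_real, inner_smul_right, h1', norm_smul, hv', mul_pow, Real.norm_eq_abs, sq_abs, hs]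
      ring
    nlinarith [norm_nonneg (z - r • v)]
  · have : ‖z + r • v‖ ^ 2 = 1 := by
      rw [norm_add_sq_real, inner_smul_right, h1', norm_smul, hv', mul_pow, Real.norm_eq_abs, sq_abs, hs]
      ring
    nlinarith [norm_nonneg (z + r • v)]
  · rw [inner_sub_left, inner_add_right, inner_add_right, inner_smul_left, inner_smul_left, inner_smul_right, inner_smul_right,
      h1, h1', real_inner_self_eq_norm_sq, real_inner_self_eq_norm_sq, hv']
    simp
    nlinarith

/-- The entry and exit points are independent and uniform. -/
lemma XY_law : (kinematic 3).map XY = (sigmaN 3).prod (sigmaN 3) := by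
  have : IsProbabilityMeasure ((kinematic 3).map XY) :=
    Measure.isProbabilityMeasure_map XY_meas.aemeasurable
  have hSS : MeasurableSet (unitSphere 3 ×ˢ unitSphere 3) := meas_sphere.prod meas_sphere
  have hin : Measurable (fun p : En 3 × En 3 => ⟪p.1, p.2⟫) := by fun_prop
  apply diag_inv_unique
  · intro g
    rw [Measure.map_map (by fun_prop) XY_meas]
    have : Prod.map g g ∘ XY = XY ∘ Prod.map g g := by
      ext1 p
      simp [XY, Xpt, Ypt, Prod.map]
    rw [this, ← Measure.map_map XY_meas (by fun_prop), kin_inv g]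
  · intro g
    rw [← Measure.map_prod_map _ _ (by fun_prop) (by fun_prop), sigma_inv]
  · refine (ae_map_iff (p := fun p => p ∈ unitSphere 3 ×ˢ unitSphere 3) XY_meas.aemeasurable hSS).2 ?_
    rw [ae_iff]
    change kinematic 3 (XY ⁻¹' (unitSphere 3 ×ˢ unitSphere 3)ᶜ) = 0
    rw [kin_apply (XY_meas hSS.compl)]
    rw [← lintegral_zero (μ := sigmaN 3)]
    apply lintegral_congr_ae
    filter_upwards [sigma_ae] with v hv
    refine measure_mono_null ?_ (ae_iff.1 (lambda_ae v))
    intro z hz hz'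
    exact hz (XY_norm hv hz').1
  · rw [ae_iff]
    have hh : (sigmaN 3) (unitSphere 3)ᶜ = 0 := ae_iff.1 sigma_ae
    refine measure_mono_null (t := ((unitSphere 3)ᶜ ×ˢ Set.univ) ∪ (Set.univ ×ˢ (unitSphere 3)ᶜ)) ?_ ?_
    · rintro ⟨x, y⟩ h
      by_cases hx : x ∈ unitSphere 3
      · exact Or.inr ⟨trivial, fun hy => h ⟨hx, hy⟩⟩
      · exact Or.inl ⟨hx, trivial⟩
    · rw [measure_union_null_iff, Measure.prod_prod, Measure.prod_prod, hh]
      simp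
  · have l1 : ((kinematic 3).map XY).map (fun p => ⟪p.1, p.2⟫) = Uu := by
      ext s hs
      rw [Measure.map_apply hin hs, Measure.map_apply XY_meas (hin hs), kin_apply (XY_meas (hin hs))]
      have : ∫⁻ v, lambdaN 3 v (Prod.mk v ⁻¹' (XY ⁻¹' ((fun p : En 3 × En 3 => ⟪p.1, p.2⟫) ⁻¹' s))) ∂(sigmaN 3)
          = ∫⁻ v, Uu s ∂(sigmaN 3) := by
        apply lintegral_congr_ae
        filter_upwards [sigma_ae] with v hv
        rw [← lambda_law hv, Measure.map_apply (by fun_prop) hs]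
        apply measure_congr
        filter_upwards [lambda_ae v] with z hz
        have := (XY_norm hv hz).2
        apply propext
        change ⟪(XY (v, z)).1, (XY (v, z)).2⟫ ∈ s ↔ 2 * ‖z‖ ^ 2 - 1 ∈ s
        rw [this]
      rw [this]; simp
    have l2 : ((sigmaN 3).prod (sigmaN 3)).map (fun p => ⟪p.1, p.2⟫) = Uu := by
      ext s hs
      rw [Measure.map_apply hin hs, Measure.prod_apply (hin hs)]
      have : ∫⁻ v, sigmaN 3 (Prod.mk v ⁻¹' ((fun p : En 3 × En 3 => ⟪p.1, p.2⟫) ⁻¹' s)) ∂(sigmaN 3)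
          = ∫⁻ v, Uu s ∂(sigmaN 3) := by
        apply lintegral_congr_ae
        filter_upwards [sigma_ae] with v hv
        rw [← sigma_law hv, Measure.map_apply (by fun_prop) hs]
        rfl
      rw [this]; simp
    rw [l1, l2]



/-- The probability that a random line intersects `A ⊆ S²` in exactly one of its two
intersection points with the sphere equals `2·σ(A)·(1 - σ(A))`. -/
theorem prob_exactly_one_point_in_A (A : Set (En 3)) (hA : MeasurableSet A)
    (hAS : A ⊆ unitSphere 3) :
    kinematic 3 {p : En 3 × En 3 |
        (Xpt 3 p ∈ A ∧ Ypt 3 p ∉ A) ∨ (Xpt 3 p ∉ A ∧ Ypt 3 p ∈ A)} =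
      2 * sigmaN 3 A * (1 - sigmaN 3 A) := by
  have hset : {p : En 3 × En 3 | (Xpt 3 p ∈ A ∧ Ypt 3 p ∉ A) ∨ (Xpt 3 p ∉ A ∧ Ypt 3 p ∈ A)}
      = XY ⁻¹' ((A ×ˢ Aᶜ) ∪ (Aᶜ ×ˢ A)) := by
    ext p; rfl
  have hm : MeasurableSet ((A ×ˢ Aᶜ) ∪ (Aᶜ ×ˢ A)) :=
    (hA.prod hA.compl).union (hA.compl.prod hA)
  have hd : Disjoint (A ×ˢ Aᶜ) (Aᶜ ×ˢ A) := by
    rw [Set.disjoint_left]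
    rintro ⟨x, y⟩ h1 h2
    exact h2.1 h1.1
  rw [hset, ← Measure.map_apply XY_meas hm, XY_law, measure_union hd (hA.compl.prod hA),
    Measure.prod_prod, Measure.prod_prod, prob_compl_eq_one_sub hA]
  ring

end
end

section
/- Let n ≥ 2, and let μ be the normalized kinematic measure on directed lines meeting the unit sphere S^{n−1} ⊂ ℝⁿ, with entry and exit points X(v,z) and Y(v,z). Then the expected inner product of the entry and exit points is ∫ ⟨X(v,z), Y(v,z)⟩ dμ(v,z) = (n − 3)/(n + 1). In particular, this expectation vanishes if and only if n = 3. -/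
open MeasureTheory Metric Real Filter
open scoped ENNReal RealInnerProductSpace Topology

noncomputable section

open Submodule in
lemma exists_iso (m : ℕ) (v : En (m + 1)) (hv : ‖v‖ = 1) :
    ∃ L : En m →ₗᵢ[ℝ] En (m + 1), ∀ z, ⟪v, z⟫ = 0 ↔ z ∈ Set.range L := by
  have : Fact (Module.finrank ℝ (En (m + 1)) = m + 1) := ⟨by simp⟩
  have hv0 : v ≠ 0 := by
    rintro rfl
    simp at hv
  let B := (OrthonormalBasis.fromOrthogonalSpanSingleton (𝕜 := ℝ) m hv0).repr.symm
  refine ⟨(ℝ ∙ v)ᗮ.subtypeₗᵢ.comp B.toLinearIsometry, fun z => ?_⟩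
  rw [← Submodule.mem_orthogonal_singleton_iff_inner_right]
  constructor
  · intro hz
    exact ⟨B.symm ⟨z, hz⟩, by simp⟩
  · rintro ⟨w, rfl⟩
    exact (B w).2

lemma disc_eq_image (m : ℕ) (v : En (m + 1)) (L : En m →ₗᵢ[ℝ] En (m + 1))
    (hL : ∀ z, ⟪v, z⟫ = 0 ↔ z ∈ Set.range L) : disc (m + 1) v = L '' Metric.ball 0 1 := by
  ext z
  simp only [disc, Set.mem_ofPred_eq, hL]
  constructor
  · rintro ⟨⟨w, rfl⟩, h⟩
    exact ⟨w, by simpa using h, rfl⟩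
  · rintro ⟨w, hw, rfl⟩
    exact ⟨⟨w, rfl⟩, by simpa using hw⟩

lemma cast_sub (m : ℕ) : ((m + 1 : ℕ) : ℝ) - 1 = (m : ℝ) := by push_cast; ring

instance haar_inst (m : ℕ) : (μH[(m : ℝ)] : Measure (En m)).IsAddHaarMeasure := by
  have := isAddHaarMeasure_hausdorffMeasure (E := En m)
  simpa using this

/-- normalized measure on the ball -/
def nuN (m : ℕ) : Measure (En m) :=
  (μH[(m : ℝ)] (Metric.ball (0 : En m) 1))⁻¹ •
    (μH[(m : ℝ)] : Measure (En m)).restrict (Metric.ball 0 1)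

lemma ball_ne_zero (m : ℕ) : μH[(m : ℝ)] (Metric.ball (0 : En m) 1) ≠ 0 :=
  (Metric.measure_ball_pos _ _ one_pos).ne'

lemma ball_ne_top (m : ℕ) : μH[(m : ℝ)] (Metric.ball (0 : En m) 1) ≠ ⊤ :=
  measure_ball_lt_top.ne

instance nu_prob (m : ℕ) : IsProbabilityMeasure (nuN m) := by
  constructor
  simp only [nuN, Measure.smul_apply, Measure.restrict_apply MeasurableSet.univ, Set.univ_inter,
    smul_eq_mul]
  exact ENNReal.inv_mul_cancel (ball_ne_zero m) (ball_ne_top m)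

lemma lambda_eq_map (m : ℕ) (v : En (m + 1)) (L : En m →ₗᵢ[ℝ] En (m + 1))
    (hL : ∀ z, ⟪v, z⟫ = 0 ↔ z ∈ Set.range L) :
    lambdaN (m + 1) v = (nuN m).map L := by
  have hm : (0 : ℝ) ≤ m := Nat.cast_nonneg m
  have hme : MeasurableEmbedding L := L.isometry.isClosedEmbedding.measurableEmbedding
  rw [lambdaN, nuN, disc_eq_image m v L hL, cast_sub,
    L.isometry.hausdorffMeasure_image (Or.inl hm), Measure.map_smul]
  congr 1
  rw [← Set.preimage_image_eq (Metric.ball (0 : En m) 1) L.injective, ← hme.restrict_map,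
    L.isometry.map_hausdorffMeasure (Or.inl hm), Measure.restrict_restrict,
    Set.preimage_image_eq _ L.injective,
    Set.inter_eq_left.2 (Set.image_subset_range _ _)]
  exact hme.measurableSet_image.2 measurableSet_ball

lemma sphere_ne_zero (m : ℕ) : μH[(m : ℝ)] (unitSphere (m + 1)) ≠ 0 := by
  have hm : (0 : ℝ) ≤ m := Nat.cast_nonneg m
  let e : En (m + 1) := EuclideanSpace.single 0 1
  have he : ‖e‖ = 1 := by simp [e]
  obtain ⟨L, hL⟩ := exists_iso m e he
  let P : En (m + 1) →L[ℝ] En (m + 1) :=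
    ContinuousLinearMap.id ℝ _ - (innerSL ℝ e).smulRight e
  intro h0
  have h1 := P.lipschitz.hausdorffMeasure_image_le hm (unitSphere (m + 1))
  rw [h0, mul_zero, nonpos_iff_eq_zero] at h1
  apply ball_ne_zero m
  rw [← L.isometry.hausdorffMeasure_image (Or.inl hm)]
  refine measure_mono_null ?_ h1
  rw [← disc_eq_image m e L hL]
  rintro z ⟨hz, hz1⟩
  have hs : (0 : ℝ) ≤ 1 - ‖z‖ ^ 2 := by nlinarith [norm_nonneg z]
  refine ⟨z + √(1 - ‖z‖ ^ 2) • e, ?_, ?_⟩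
  · rw [unitSphere, mem_sphere_zero_iff_norm, ← sq_eq_sq₀ (norm_nonneg _) zero_le_one,
      norm_add_sq_real, norm_smul, he, inner_smul_right, real_inner_comm, hz]
    simp [Real.sq_sqrt hs]
  · simp [P, inner_add_right, inner_smul_right, hz, he]

lemma half_sphere (m : ℕ) (e : En (m + 1)) (he : ‖e‖ = 1) :
    ∃ T : Set (En (m + 1)), μH[(m : ℝ)] T < ⊤ ∧ ∀ x ∈ unitSphere (m + 1), ⟪e, x⟫ ≤ 0 → x ∈ T := by
  have hm : (0 : ℝ) ≤ m := Nat.cast_nonneg m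
  obtain ⟨L, hL⟩ := exists_iso m e he
  let f : En m → En (m + 1) := fun w => stereoInvFunAux e (L w)
  have hf : ContDiff ℝ 1 f := contDiff_stereoInvFunAux.comp L.contDiff
  obtain ⟨K, hK⟩ := hf.contDiffOn.exists_lipschitzOnWith one_ne_zero
    (convex_closedBall (0 : En m) 2) (isCompact_closedBall _ _)
  refine ⟨f '' Metric.closedBall 0 2, ?_, ?_⟩
  · refine (hK.hausdorffMeasure_image_le hm).trans_lt ?_
    exact ENNReal.mul_lt_top (ENNReal.rpow_lt_top_of_nonneg hm ENNReal.coe_ne_top)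
      measure_closedBall_lt_top
  · intro x hx hxe
    have hx1 : ‖x‖ = 1 := by simpa [unitSphere] using hx
    set t := ⟪e, x⟫ with ht
    have hz : ⟪e, (2 / (1 - t)) • (x - t • e)⟫ = 0 := by
      simp [inner_smul_right, inner_sub_right, he, ← ht]
    obtain ⟨w, hw⟩ := (hL _).1 hz
    have h1t : 0 < 1 - t := by linarith
    have hn : ‖x - t • e‖ ^ 2 = 1 - t ^ 2 := by
      rw [norm_sub_sq_real, norm_smul, hx1, he, inner_smul_right, real_inner_comm, ← ht]
      simp; ring
    have ht1 : -1 ≤ t := by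
      have := neg_le_of_abs_le (abs_real_inner_le_norm e x)
      rw [he, hx1] at this
      linarith
    have hn2 : ‖L w‖ ^ 2 = 4 * (1 + t) / (1 - t) := by
      rw [hw, norm_smul, mul_pow, hn, Real.norm_eq_abs, sq_abs]
      field_simp
      ring
    refine ⟨w, ?_, ?_⟩
    · rw [mem_closedBall_zero_iff, ← L.norm_map]
      have : ‖L w‖ ^ 2 ≤ 2 ^ 2 := by
        rw [hn2, div_le_iff₀ h1t]
        linarith
      exact (sq_le_sq₀ (norm_nonneg _) (by norm_num)).1 this
    · simp only [f, stereoInvFunAux_apply]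
      rw [hn2, hw]
      have e1 : (4 * (1 + t) / (1 - t) + 4)⁻¹ = (1 - t) / 8 := by
        field_simp
        ring
      have e2 : 4 * (1 + t) / (1 - t) - 4 = 8 * t / (1 - t) := by
        field_simp
        ring
      rw [e1, e2, smul_add, smul_smul, smul_smul, smul_smul]
      have e3 : (1 - t) / 8 * 4 * (2 / (1 - t)) = 1 := by
        field_simp
        norm_num
      have e4 : (1 - t) / 8 * (8 * t / (1 - t)) = t := by
        field_simp
      rw [e3, e4]
      simp

lemma sphere_ne_top (m : ℕ) : μH[(m : ℝ)] (unitSphere (m + 1)) ≠ ⊤ := by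
  let e : En (m + 1) := EuclideanSpace.single 0 1
  have he : ‖e‖ = 1 := by simp [e]
  obtain ⟨T, hT, hT'⟩ := half_sphere m e he
  obtain ⟨U, hU, hU'⟩ := half_sphere m (-e) (by simpa using he)
  refine ((measure_mono ?_).trans_lt
    ((measure_union_le T U).trans_lt (ENNReal.add_lt_top.2 ⟨hT, hU⟩))).ne
  intro x hx
  rcases le_total ⟪e, x⟫ 0 with h | h
  · exact Or.inl (hT' x hx h)
  · exact Or.inr (hU' x hx (by simpa using h))

instance sigma_prob (m : ℕ) : IsProbabilityMeasure (sigmaN (m + 1)) := by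
  constructor
  simp only [sigmaN, Measure.smul_apply, Measure.restrict_apply MeasurableSet.univ, Set.univ_inter,
    smul_eq_mul, cast_sub]
  exact ENNReal.inv_mul_cancel (sphere_ne_zero m) (sphere_ne_top m)

lemma sigma_ae_s8 (m : ℕ) : ∀ᵐ v ∂(sigmaN (m + 1)), ‖v‖ = 1 := by
  apply Measure.ae_smul_measure
  filter_upwards [ae_restrict_mem (by exact Metric.isClosed_sphere.measurableSet)] with v hv
  simpa [unitSphere] using hv

lemma nu_ae (m : ℕ) : ∀ᵐ w ∂(nuN m), ‖w‖ < 1 := by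
  apply Measure.ae_smul_measure
  filter_upwards [ae_restrict_mem (by exact measurableSet_ball)] with v hv
  simpa using hv

lemma kinematic_eq (m : ℕ) : ∃ R : En (m + 1) → En m → En (m + 1),
    Measurable (fun p : En (m + 1) × En m => (p.1, R p.1 p.2)) ∧
    (∀ v w, ‖R v w‖ = ‖w‖) ∧ 
    kinematic (m + 1) = ((sigmaN (m + 1)).prod (nuN m)).map (fun p => (p.1, R p.1 p.2)) := by
  let e : En (m + 1) := EuclideanSpace.single 0 1
  have he : ‖e‖ = 1 := by simp [e]
  obtain ⟨L, hL⟩ := exists_iso m e he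
  let Q : En (m + 1) → En (m + 1) ≃ₗᵢ[ℝ] En (m + 1) := fun v => (ℝ ∙ (v - e))ᗮ.reflection
  have hQ : ∀ v z, Q v z = z - (2 * (⟪v - e, z⟫ / ‖v - e‖ ^ 2)) • (v - e) := by
    intro v z
    simp only [Q]
    rw [Submodule.reflection_orthogonal_apply, Submodule.reflection_singleton_apply]
    simp [mul_smul, two_smul]
  have hmeas : Measurable (fun p : En (m + 1) × En m => (p.1, Q p.1 (L p.2))) := by
    simp only [hQ]
    have hLm : Measurable L := L.continuous.measurable
    have h2 : Measurable (fun p : En (m + 1) × En m => L p.2) := hLm.comp measurable_snd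
    have h1 : Measurable (fun p : En (m + 1) × En m => p.1 - e) := measurable_fst.sub_const e
    exact measurable_fst.prodMk
      (h2.sub ((((h1.inner h2).div (h1.norm.pow_const 2)).const_mul 2).smul h1))
  refine ⟨fun v w => Q v (L w), hmeas, fun v w => by simp, ?_⟩
  rw [Measure.prod_def, ← Measure.bind_dirac_eq_map _ hmeas,
    Measure.bind_bind Measurable.map_prodMk_left.aemeasurable
      (show Measurable (fun p : En (m + 1) × En m =>
        Measure.dirac (p.1, Q p.1 (L p.2))) from Measure.measurable_dirac.comp hmeas).aemeasurable, kinematic]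
  apply Measure.bind_congr_right
  filter_upwards [sigma_ae_s8 m] with v hv
  have hQv : Q v v = e := Submodule.reflection_sub (by rw [hv, he])
  rw [Measure.bind_dirac_eq_map _ hmeas, Measure.map_map hmeas measurable_prodMk_left,
    lambda_eq_map m v ((Q v).toLinearIsometry.comp L), Measure.dirac_prod,
    Measure.map_map measurable_prodMk_left]
  · rfl
  · exact (LinearIsometry.continuous _).measurable
  · intro z
    rw [← (Q v).inner_map_map, hQv, hL]
    constructor
    · rintro ⟨w, hw⟩
      refine ⟨w, ?_⟩
      simp [hw, Q]
    · rintro ⟨w, rfl⟩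
      refine ⟨w, ?_⟩
      simp [Q]

lemma integral_nu (m : ℕ) (hm : 1 ≤ m) :
    ∫ w, (2 * ‖w‖ ^ 2 - 1) ∂(nuN m) = ((m : ℝ) - 2) / ((m : ℝ) + 2) := by
  have : Nontrivial (En m) := by
    have : Nonempty (Fin m) := ⟨⟨0, hm⟩⟩
    infer_instance
  have hb : (μH[(m : ℝ)] : Measure (En m)).real (Metric.ball 0 1) ≠ 0 := by
    rw [Measure.real, ENNReal.toReal_ne_zero]
    exact ⟨ball_ne_zero m, ball_ne_top m⟩
  let f : ℝ → ℝ := Set.indicator (Set.Iio 1) (fun r => 2 * r ^ 2 - 1)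
  have h1 : ∫ w in Metric.ball (0 : En m) 1, (2 * ‖w‖ ^ 2 - 1) ∂(μH[(m : ℝ)])
      = ∫ w : En m, f ‖w‖ ∂(μH[(m : ℝ)]) := by
    rw [← integral_indicator measurableSet_ball]
    congr 1
    ext w
    simp [f, Set.indicator]
  have h2 : ∫ y in Set.Ioi (0 : ℝ), y ^ (m - 1) • f y = ((m : ℝ) - 2) / (m * ((m : ℝ) + 2)) := by
    have : ∀ y : ℝ, y ^ (m - 1) • f y
        = Set.indicator (Set.Iio 1) (fun r => 2 * r ^ (m + 1) - r ^ (m - 1)) y := by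
      intro y
      obtain ⟨k, rfl⟩ : ∃ k, m = k + 1 := ⟨m - 1, by omega⟩
      simp only [f, Set.indicator]
      split_ifs
      · simp; ring
      · simp
    simp_rw [this]
    rw [setIntegral_indicator measurableSet_Iio, Set.Ioi_inter_Iio,
      ← integral_Ioc_eq_integral_Ioo, ← intervalIntegral.integral_of_le zero_le_one,
      intervalIntegral.integral_sub (Continuous.intervalIntegrable (by fun_prop) _ _)
        (Continuous.intervalIntegrable (by fun_prop) _ _),
      intervalIntegral.integral_const_mul, integral_pow, integral_pow]
    obtain ⟨k, rfl⟩ : ∃ k, m = k + 1 := ⟨m - 1, by omega⟩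
    simp
    field_simp
    ring
  rw [nuN, integral_smul_measure, h1, integral_fun_norm_addHaar]
  simp only [finrank_euclideanSpace, Fintype.card_fin]
  rw [h2, ENNReal.toReal_inv]
  change (Measure.real _ _)⁻¹ • _ = _
  have : (m : ℝ) ≠ 0 := by positivity
  simp only [smul_eq_mul, nsmul_eq_mul]
  field_simp

lemma integral_main (m : ℕ) (hm : 1 ≤ m) :
    (∫ p, ⟪Xpt (m + 1) p, Ypt (m + 1) p⟫ ∂(kinematic (m + 1)))
      = ((m : ℝ) - 2) / ((m : ℝ) + 2) := by
  obtain ⟨R, hR, hRn, hk⟩ := kinematic_eq m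
  have hg : Measurable (fun p : En (m + 1) × En (m + 1) => ⟪Xpt (m + 1) p, Ypt (m + 1) p⟫) := by
    apply Continuous.measurable
    unfold Xpt Ypt
    fun_prop
  rw [hk, integral_map hR.aemeasurable hg.aestronglyMeasurable]
  have : ∀ᵐ p ∂((sigmaN (m + 1)).prod (nuN m)),
      ⟪Xpt (m + 1) (p.1, R p.1 p.2), Ypt (m + 1) (p.1, R p.1 p.2)⟫ = 2 * ‖p.2‖ ^ 2 - 1 := by
    have a1 := Measure.quasiMeasurePreserving_fst (μ := sigmaN (m + 1)) (ν := nuN m) |>.ae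
      (sigma_ae_s8 m)
    have a2 := Measure.quasiMeasurePreserving_snd (μ := sigmaN (m + 1)) (ν := nuN m) |>.ae
      (nu_ae m)
    filter_upwards [a1, a2] with p h1 h2
    have hs : (0 : ℝ) ≤ 1 - ‖p.2‖ ^ 2 := by nlinarith [norm_nonneg p.2]
    simp only [Xpt, Ypt, hRn]
    rw [inner_sub_left, inner_add_right, inner_add_right, real_inner_self_eq_norm_sq, hRn,
      real_inner_self_eq_norm_sq, norm_smul, h1, real_inner_comm (R p.1 p.2)]
    simp [Real.sq_sqrt hs]
    ring
  rw [integral_congr_ae this, integral_fun_snd (fun w : En m => 2 * ‖w‖ ^ 2 - 1),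
    integral_nu m hm]
  simp

/-- The expected inner product of the entry and exit points of a random line meeting
`S^{n-1}` equals `(n-3)/(n+1)`; in particular it vanishes if and only if `n = 3`. -/
theorem integral_inner_entry_exit (n : ℕ) (hn : 2 ≤ n) :
    (∫ p, ⟪Xpt n p, Ypt n p⟫ ∂(kinematic n)) = ((n : ℝ) - 3) / ((n : ℝ) + 1) ∧
      ((∫ p, ⟪Xpt n p, Ypt n p⟫ ∂(kinematic n)) = 0 ↔ n = 3) := by
  have key : (∫ p, ⟪Xpt n p, Ypt n p⟫ ∂(kinematic n)) = ((n : ℝ) - 3) / ((n : ℝ) + 1) := by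
    obtain ⟨m, rfl⟩ : ∃ m, n = m + 1 := ⟨n - 1, by omega⟩
    rw [integral_main m (by omega)]
    push_cast
    congr 1 <;> ring
  refine ⟨key, ?_⟩
  rw [key]
  have h1 : (n : ℝ) + 1 ≠ 0 := by positivity
  rw [div_eq_zero_iff, or_iff_left h1, sub_eq_zero]
  exact_mod_cast Iff.rfl

end
end
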